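/- Let K be a field, n ≥ 3, and let S_n be the monoid presented by generators a_1, …, a_n and relations a_1 a_2 ⋯ a_n = a_{σ(1)} ⋯ a_{σ(n)} for σ in the cyclic group generated by the n-cycle. Then the monoid algebra K[S_n] is right primitive (i.e. admits a faithful simple right module) if and only if K is countable. Likewise, K[S_n] is left primitive if and only if K is countable. -/

import Mathlib

/-- The word `a_{σ(1)} a_{σ(2)} ⋯ a_{σ(n)}` in the free monoid on `n` generators. -/
def permWord (n : ℕ) (σ : Equiv.Perm (Fin n)) : FreeMonoid (Fin n) :=
  ((List.finRange n).map fun i => FreeMonoid.of (σ i)).prod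

/-- The defining relations `a_1 a_2 ⋯ a_n = a_{σ(1)} a_{σ(2)} ⋯ a_{σ(n)}`, where `σ` runs
through the cyclic subgroup of `Sym_n` generated by the `n`-cycle `(1,2,…,n)` (i.e. `finRotate n`). -/
def cycRel (n : ℕ) : FreeMonoid (Fin n) → FreeMonoid (Fin n) → Prop :=
  fun x y => x = permWord n 1 ∧ ∃ k : ℕ, y = permWord n (finRotate n ^ k)

/-- The monoid `S_n` presented by generators `a_1, …, a_n` and the above relations. -/
def Scyc (n : ℕ) : Type := (conGen (cycRel n)).Quotient

instance (n : ℕ) : Monoid (Scyc n) := Con.monoid _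

/-- The generator `a_i` of `S_n`. -/
def agen {n : ℕ} (i : Fin n) : Scyc n := (conGen (cycRel n)).mk' (FreeMonoid.of i)

/-- The element `z = a_1 a_2 ⋯ a_n` of `S_n`. -/
def zc (n : ℕ) : Scyc n := ((List.finRange n).map agen).prod

/-- A nontrivial free group surjects onto `ℤ`. -/
theorem IsFreeGroup.exists_monoidHom_int_ne_one (G : Type*) [Group G] [IsFreeGroup G]
    [Nontrivial G] : ∃ f : G →* Multiplicative ℤ, f ≠ 1 := by
  have hne : Nonempty (IsFreeGroup.Generators G) := by
    by_contra h
    rw [not_nonempty_iff] at h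
    have : Subsingleton G := (IsFreeGroup.toFreeGroup G).toEquiv.subsingleton
    exact not_subsingleton G this
  obtain ⟨x⟩ := hne
  refine ⟨IsFreeGroup.lift fun _ => Multiplicative.ofAdd 1, fun h => ?_⟩
  have := DFunLike.congr_fun h (IsFreeGroup.of x)
  rw [IsFreeGroup.lift_of] at this
  exact absurd (congrArg Multiplicative.toAdd this) one_ne_zero

/-- If `g` and `h` are weights on `G` whose sum only depends on the product, then a unique product
of the maximal layers is a unique product. -/
theorem UniqueMul.of_filter_max {G : Type*} [Mul G] {A B : Finset G} {g h : G → ℤ}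
    (hgh : ∀ a ∈ A, ∀ b ∈ B, ∀ a' ∈ A, ∀ b' ∈ B, a * b = a' * b' → g a + h b = g a' + h b')
    {M N : ℤ} (hM : ∀ a ∈ A, g a ≤ M) (hN : ∀ b ∈ B, h b ≤ N) {a b : G}
    (ha : a ∈ A.filter (g · = M)) (hb : b ∈ B.filter (h · = N))
    (hu : UniqueMul (A.filter (g · = M)) (B.filter (h · = N)) a b) : UniqueMul A B a b := by
  intro a' b' ha' hb' e
  rw [Finset.mem_filter] at ha hb
  have h1 := hgh a' ha' b' hb' a ha.1 b hb.1 e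
  have h2 := hM a' ha'
  have h3 := hN b' hb'
  exact hu (Finset.mem_filter.2 ⟨ha', by lia⟩) (Finset.mem_filter.2 ⟨hb', by lia⟩) e

/-- If a subset of a free group has a nontrivial element, then some homomorphism from the subgroup
that it generates to `ℤ` does not vanish on it. -/
theorem IsFreeGroup.exists_weight {G : Type*} [Group G] [IsFreeGroup G] (s : Set G)
    (hs : ∃ x ∈ s, x ≠ 1) :
    ∃ g : G → ℤ, (∀ x ∈ Subgroup.closure s, ∀ y ∈ Subgroup.closure s, g (x * y) = g x + g y) ∧
      ∃ x ∈ s, g x ≠ 0 := by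
  classical
  obtain ⟨x, hx, hx1⟩ := hs
  let H := Subgroup.closure s
  have : Nontrivial H :=
    ⟨⟨x, Subgroup.subset_closure hx⟩, 1, fun h => hx1 (congrArg Subtype.val h)⟩
  obtain ⟨f, hf⟩ := IsFreeGroup.exists_monoidHom_int_ne_one H
  let g : G → ℤ := fun x => if h : x ∈ H then (f ⟨x, h⟩).toAdd else 0
  have hg : ∀ x (h : x ∈ H), g x = (f ⟨x, h⟩).toAdd := fun x h => dif_pos h
  refine ⟨g, fun x hx y hy => ?_, ?_⟩
  · rw [hg x hx, hg y hy, hg _ (mul_mem hx hy), ← toAdd_mul, ← map_mul]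
    rfl
  · by_contra! hc
    refine hf (MonoidHom.eq_of_eqOn_dense (s := Subtype.val ⁻¹' s)
      (Subgroup.closure_closure_coe_preimage) fun x hx => ?_)
    have := hc x hx
    rw [hg x x.2] at this
    exact this

/-- Free groups have unique products. -/
instance IsFreeGroup.instUniqueProds {G : Type*} [Group G] [IsFreeGroup G] : UniqueProds G where
  uniqueMul_of_nonempty {A B} hA hB := by
    classical
    induction hm : A.card + B.card using Nat.strong_induction_on generalizing A B with
    | _ m ih =>
      by_cases hc : A.card ≤ 1 ∧ B.card ≤ 1
      · exact UniqueMul.of_card_le_one hA hB hc.1 hc.2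
      obtain ⟨a₀, ha₀⟩ := hA
      obtain ⟨b₀, hb₀⟩ := hB
      let s : Set G := (fun a => a₀⁻¹ * a) '' A ∪ (fun b => b * b₀⁻¹) '' B
      have hsA : ∀ a ∈ A, a₀⁻¹ * a ∈ s := fun a ha => Or.inl ⟨a, ha, rfl⟩
      have hsB : ∀ b ∈ B, b * b₀⁻¹ ∈ s := fun b hb => Or.inr ⟨b, hb, rfl⟩
      have hs : ∃ x ∈ s, x ≠ 1 := by
        by_contra! h
        refine hc ⟨Finset.card_le_one_iff_subset_singleton.2 ⟨a₀, fun a ha => ?_⟩,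
          Finset.card_le_one_iff_subset_singleton.2 ⟨b₀, fun b hb => ?_⟩⟩
        · exact Finset.mem_singleton.2 (inv_mul_eq_one.1 (h _ (hsA a ha))).symm
        · exact Finset.mem_singleton.2 (mul_inv_eq_one.1 (h _ (hsB b hb)))
      obtain ⟨g, hg, x, hx, hgx⟩ := IsFreeGroup.exists_weight s hs
      obtain ⟨a₁, ha₁, hM⟩ := A.exists_max_image (fun a => g (a₀⁻¹ * a)) ⟨a₀, ha₀⟩
      obtain ⟨b₁, hb₁, hN⟩ := B.exists_max_image (fun b => g (b * b₀⁻¹)) ⟨b₀, hb₀⟩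
      set A' := A.filter (fun a => g (a₀⁻¹ * a) = g (a₀⁻¹ * a₁))
      set B' := B.filter (fun b => g (b * b₀⁻¹) = g (b₁ * b₀⁻¹))
      have hg1 : g 1 = 0 := by
        have := hg 1 (one_mem _) 1 (one_mem _)
        rw [mul_one] at this
        lia
      have hlt : A'.card + B'.card < m := by
        by_contra! hle
        have h1 := Finset.card_filter_le A (fun a => g (a₀⁻¹ * a) = g (a₀⁻¹ * a₁))
        have h2 := Finset.card_filter_le B (fun b => g (b * b₀⁻¹) = g (b₁ * b₀⁻¹))
        have h3 := Finset.card_filter_eq_iff.1 (show A'.card = A.card by lia)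
        have h4 := Finset.card_filter_eq_iff.1 (show B'.card = B.card by lia)
        have h5 := h3 a₀ ha₀
        have h6 := h4 b₀ hb₀
        simp only [inv_mul_cancel, mul_inv_cancel, hg1] at h5 h6
        rcases hx with ⟨a, ha, rfl⟩ | ⟨b, hb, rfl⟩
        · exact hgx ((h3 a ha).trans h5.symm)
        · exact hgx ((h4 b hb).trans h6.symm)
      obtain ⟨a, ha, b, hb, hu⟩ := ih _ hlt (A := A') (B := B')
        ⟨a₁, Finset.mem_filter.2 ⟨ha₁, rfl⟩⟩ ⟨b₁, Finset.mem_filter.2 ⟨hb₁, rfl⟩⟩ rfl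
      refine ⟨a, (Finset.mem_filter.1 ha).1, b, (Finset.mem_filter.1 hb).1,
        UniqueMul.of_filter_max (g := fun a => g (a₀⁻¹ * a)) (h := fun b => g (b * b₀⁻¹))
          (fun a ha b hb a' ha' b' hb' e => ?_) hM hN ha hb hu⟩
      rw [← hg _ (Subgroup.subset_closure (hsA a ha)) _ (Subgroup.subset_closure (hsB b hb)),
        ← hg _ (Subgroup.subset_closure (hsA a' ha')) _ (Subgroup.subset_closure (hsB b' hb'))]
      congr 1
      simp only [mul_assoc]
      rw [← mul_assoc a, e, mul_assoc]

open Polynomial in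
/-- A nonzero polynomial in a central transcendental element acts bijectively on a faithful simple
module. -/
theorem bijective_aeval_smul_of_transcendental {K A V : Type*} [Field K] [Ring A] [Algebra K A]
    [AddCommGroup V] [Module A V] [IsSimpleModule A V] [FaithfulSMul A V] {z : A}
    (hz : z ∈ Subalgebra.center K A) (ht : Transcendental K z) {p : K[X]} (hp : p ≠ 0) :
    Function.Bijective fun v : V => aeval z p • v := by
  have hc : ∀ a, a * aeval z p = aeval z p * a := Subalgebra.mem_center_iff.1 <|
    Algebra.adjoin_le (Set.singleton_subset_iff.2 hz) (aeval_mem_adjoin_singleton K z)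
  let f : V →ₗ[A] V :=
    { toFun := fun v => aeval z p • v
      map_add' := smul_add _
      map_smul' := fun a v => by rw [RingHom.id_apply, ← mul_smul, ← hc, mul_smul] }
  refine LinearMap.bijective_of_ne_zero (f := f) fun hf => hp ?_
  refine (transcendental_iff.1 ht) p (FaithfulSMul.eq_of_smul_eq_smul (α := V) fun v => ?_)
  rw [zero_smul]
  exact LinearMap.congr_fun hf v

open Polynomial in
/-- If a countable-dimensional algebra with a central transcendental element has a faithful simple
module, then the base field is countable. -/
theorem countable_of_faithful_simple_module {K A V : Type*} [Field K] [Ring A]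
    [Algebra K A] (hA : Module.rank K A ≤ Cardinal.aleph0) {z : A}
    (hz : z ∈ Subalgebra.center K A) (ht : Transcendental K z)
    [AddCommGroup V] [Module A V] [IsSimpleModule A V] [FaithfulSMul A V] : Countable K := by
  classical
  let _ : Module K V := Module.compHom V (algebraMap K A)
  have : IsScalarTower K A V := ⟨fun c a v => by rw [Algebra.smul_def, mul_smul]; rfl⟩
  have : Nontrivial V := IsSimpleModule.nontrivial A V
  obtain ⟨v, hv⟩ := exists_ne (0 : V)
  choose u hu using fun c : K =>
    (bijective_aeval_smul_of_transcendental (V := V) hz ht (X_sub_C_ne_zero c)).surjective v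
  have hli : LinearIndependent K u := by
    rw [linearIndependent_iff']
    intro s g hs i hi
    let p : K[X] := ∑ c ∈ s, C (g c) * ∏ d ∈ s.erase c, (X - C d)
    have hpv : aeval z p • v = 0 := by
      rw [← smul_zero (aeval z (∏ c ∈ s, (X - C c))), ← hs, map_sum, Finset.sum_smul,
        Finset.smul_sum]
      refine Finset.sum_congr rfl fun c hc => ?_
      rw [← Finset.prod_erase_mul s _ hc, map_mul, map_mul, aeval_C, mul_smul, mul_smul,
        ← algebraMap_smul A (g c) (u c), ← mul_smul _ _ (u c), ← Algebra.commutes, mul_smul,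
        ← mul_smul _ (algebraMap K A (g c)), ← Algebra.commutes, mul_smul]
      exact congrArg _ (congrArg _ (hu c).symm)
    have hp : p = 0 := by
      by_contra hp
      exact hv <| (bijective_aeval_smul_of_transcendental (V := V) hz ht hp).injective <| by
        simpa using hpv
    have he := congrArg (eval i) hp
    rw [eval_finsetSum, eval_zero, Finset.sum_eq_single_of_mem i hi fun c hc hci => by
      rw [eval_mul, eval_prod, Finset.prod_eq_zero (Finset.mem_erase.2 ⟨hci.symm, hi⟩) (by simp),
        mul_zero], eval_mul, eval_C, eval_prod] at he
    refine (mul_eq_zero.1 he).resolve_right (Finset.prod_ne_zero_iff.2 fun d hd => ?_)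
    simpa [sub_eq_zero] using (Finset.ne_of_mem_erase hd).symm
  have hV : Module.rank K V ≤ Cardinal.aleph0 := by
    have := LinearMap.lift_rank_le_of_surjective
      (LinearMap.toSpanSingleton A V v |>.restrictScalars K)
      (IsSimpleModule.toSpanSingleton_surjective A hv)
    exact Cardinal.lift_le_aleph0.1 (this.trans (Cardinal.lift_le_aleph0.2 hA))
  rw [← Cardinal.mk_le_aleph0_iff]
  exact Cardinal.lift_le_aleph0.1 (hli.cardinal_lift_le_rank.trans (Cardinal.lift_le_aleph0.2 hV))

/-- If `Dα ∩ Dβ = 0` in a domain, then the elements `α β ^ k` are left linearly independent. -/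
theorem eq_zero_of_sum_mul_mul_pow_eq_zero {D : Type*} [Ring D] [IsDomain D] {α β : D} (hβ : β ≠ 0)
    (hαβ : ∀ f g, f * α = g * β → f = 0) (N : ℕ) (f : ℕ → D)
    (h : ∑ k ∈ Finset.range N, f k * (α * β ^ k) = 0) : ∀ k < N, f k = 0 := by
  induction N generalizing f with
  | zero => simp
  | succ N ih =>
    have key : (∑ k ∈ Finset.range N, f (k + 1) * (α * β ^ k)) * β =
        ∑ k ∈ Finset.range N, f (k + 1) * (α * β ^ (k + 1)) := by
      rw [Finset.sum_mul]
      exact Finset.sum_congr rfl fun k _ => by simp only [pow_succ, mul_assoc]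
    rw [Finset.sum_range_succ', ← key, pow_zero, mul_one] at h
    have h0 : f 0 = 0 := hαβ _ (-∑ k ∈ Finset.range N, f (k + 1) * (α * β ^ k)) <| by
      rw [neg_mul, eq_neg_iff_add_eq_zero, add_comm, h]
    rw [h0, zero_mul, add_zero] at h
    have h1 := ih _ ((mul_eq_zero.1 h).resolve_right hβ)
    rintro (_ | k) hk
    · exact h0
    · exact h1 k (by lia)

open Polynomial in
/-- The left ideal generated by the elements `r k * (x * y ^ k) - 1` is proper when `x` and `y` are
monomials with left independent coefficients and `x` has positive degree. -/
theorem one_notMem_span_mul_sub_one {R D : Type*} [Ring R] [Ring D] [IsDomain D] {φ : R →+* D[X]}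
    (hφ : Function.Injective φ) {x y : R} {i j : ℕ} {α β : D} (hx : φ x = monomial (i + 1) α)
    (hy : φ y = monomial j β) (hβ : β ≠ 0) (hαβ : ∀ f g, f * α = g * β → f = 0) {r : ℕ → R}
    (hr : ∀ k, r k ≠ 0) :
    1 ∉ Ideal.span (Set.range fun k => r k * (x * y ^ k) - 1) := by
  classical
  intro h1
  obtain ⟨c, hc⟩ := Finsupp.mem_span_range_iff_exists_finsupp.1 h1
  obtain ⟨N, hN⟩ := c.support.exists_nat_subset_range
  rw [Finsupp.sum_of_support_subset c hN _ (by simp)] at hc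
  have hφ0 : ∀ {a}, a ≠ 0 → φ a ≠ 0 := fun ha => (map_ne_zero_iff φ hφ).2 ha
  let P : ℕ → D[X] := fun k => φ (c k) * φ (r k)
  let m : ℕ → ℕ := fun k => i + 1 + k * j
  have hyk : ∀ k, φ (x * y ^ k) = monomial (m k) (α * β ^ k) := fun k => by
    rw [map_mul, map_pow, hx, hy, monomial_pow, monomial_mul_monomial, mul_comm j]
  have hne : c.support.Nonempty := by
    rw [Finset.nonempty_iff_ne_empty, Ne, Finsupp.support_eq_empty]
    rintro rfl
    have := congrArg φ hc
    simp at this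
  obtain ⟨l, hl, hmax⟩ := c.support.exists_max_image (fun k => (P k).natDegree + m k) hne
  set d := (P l).natDegree + m l with hd
  have hP : ∀ k ∈ c.support, P k ≠ 0 := fun k hk =>
    mul_ne_zero (hφ0 (Finsupp.mem_support_iff.1 hk)) (hφ0 (hr k))
  have hcoeff : ∀ k, (φ (c k)).coeff d = 0 := by
    intro k
    by_cases hk : k ∈ c.support
    · refine coeff_eq_zero_of_natDegree_lt ?_
      have h2 : (P k).natDegree = (φ (c k)).natDegree + (φ (r k)).natDegree :=
        natDegree_mul (hφ0 (Finsupp.mem_support_iff.1 hk)) (hφ0 (hr k))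
      have h3 := hmax k hk
      simp only [m] at h3
      lia
    · rw [Finsupp.notMem_support_iff.1 hk, map_zero, coeff_zero]
  have hd0 : d ≠ 0 := by
    simp only [hd, m]
    lia
  have hsum := congrArg (fun p => (φ p).coeff d) hc
  simp only [map_sum, map_one, finsetSum_coeff, coeff_one, if_neg hd0, smul_eq_mul, mul_sub,
    map_sub, mul_one, coeff_sub, hcoeff, sub_zero] at hsum
  have hg : ∑ k ∈ Finset.range N,
      (if m k ≤ d then (P k).coeff (d - m k) else 0) * (α * β ^ k) = 0 := by
    refine Eq.trans (Finset.sum_congr rfl fun k _ => ?_) hsum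
    rw [map_mul, map_mul, hyk, ← mul_assoc (φ _), ← C_mul_X_pow_eq_monomial, ← mul_assoc (φ _ * _),
      coeff_mul_X_pow', coeff_mul_C]
    split_ifs <;> simp [P]
  have := eq_zero_of_sum_mul_mul_pow_eq_zero hβ hαβ N _ hg l (Finset.mem_range.1 (hN hl))
  rw [if_pos (by lia), show d - m l = (P l).natDegree by lia] at this
  exact hP l hl (leadingCoeff_eq_zero.1 this)

open Polynomial in
/-- A countable subring of `D[X]` containing monomials with left independent coefficients has a
faithful simple module. -/
theorem exists_faithful_simple_module_of_countable {R : Type*} {D : Type*} [Ring R] [Countable R]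
    [Ring D] [IsDomain D] {φ : R →+* D[X]} (hφ : Function.Injective φ) {x y : R} {i j : ℕ}
    {α β : D} (hx : φ x = monomial (i + 1) α) (hy : φ y = monomial j β) (hβ : β ≠ 0)
    (hαβ : ∀ f g, f * α = g * β → f = 0) :
    ∃ M : Ideal R, IsSimpleModule R (R ⧸ M) ∧ FaithfulSMul R (R ⧸ M) := by
  have : Nontrivial R := φ.domain_nontrivial
  have : Nonempty {r : R // r ≠ 0} := ⟨1, one_ne_zero⟩
  obtain ⟨r, hr⟩ := exists_surjective_nat {r : R // r ≠ 0}
  obtain ⟨M, hM, hLM⟩ := Ideal.exists_le_maximal _ <| (Ideal.ne_top_iff_one _).2 <|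
    one_notMem_span_mul_sub_one hφ hx hy hβ hαβ fun k => (r k).2
  refine ⟨M, isSimpleModule_iff_isCoatom.2 hM.out, ⟨fun {a b} hab => ?_⟩⟩
  by_contra hne
  obtain ⟨k, hk⟩ := hr ⟨a - b, sub_ne_zero.2 hne⟩
  have h1 : (a - b) * (x * y ^ k) ∈ M := by
    have := hab (Submodule.Quotient.mk (x * y ^ k))
    rw [← sub_eq_zero, ← sub_smul, ← Submodule.Quotient.mk_smul] at this
    exact (Submodule.Quotient.mk_eq_zero M).1 this
  have h2 : (a - b) * (x * y ^ k) - 1 ∈ M := by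
    have : (r k : R) * (x * y ^ k) - 1 ∈ M := hLM (Ideal.subset_span ⟨k, rfl⟩)
    rwa [hk] at this
  exact (Ideal.ne_top_iff_one M).1 hM.ne_top (by simpa using sub_mem h1 h2)

theorem val_finRotate_pow {n : ℕ} (m : ℕ) (i : Fin n) :
    ((finRotate n ^ m) i : ℕ) = (i + m) % n := by
  have := i.neZero
  induction m with
  | zero => simp [Nat.mod_eq_of_lt i.2]
  | succ m ih =>
    rw [pow_succ', Equiv.Perm.mul_apply, finRotate_apply, Fin.val_add, ih, Fin.val_one',
      ← Nat.add_mod, add_assoc]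

theorem finRotate_pow_self {n : ℕ} : finRotate n ^ n = 1 := by
  ext i
  simp [val_finRotate_pow, Nat.mod_eq_of_lt i.2]

theorem eq_of_finRotate_pow_apply_eq {n m m' : ℕ} {i : Fin n} (hm : m < n) (hm' : m' < n)
    (h : (finRotate n ^ m) i = (finRotate n ^ m') i) : m = m' := by
  have h1 := congrArg Fin.val h
  rw [val_finRotate_pow, val_finRotate_pow] at h1
  exact (Nat.ModEq.add_left_cancel' (i : ℕ) h1).eq_of_lt_of_lt hm hm'

theorem finRotate_pow_apply_succ {n : ℕ} (m : ℕ) (i : Fin n) :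
    (finRotate n ^ (m + 1)) i = (finRotate n ^ m) (finRotate n i) := by
  rw [pow_succ, Equiv.Perm.mul_apply]

/-- The product `f i * f (i + 1) * ⋯` of `m` cyclically consecutive values of `f`. -/
def arcProd {n : ℕ} {T : Type*} [Monoid T] (f : Fin n → T) (i : Fin n) (m : ℕ) : T :=
  ((List.range m).map fun t => f ((finRotate n ^ t) i)).prod

section ArcProd

variable {n : ℕ} {T : Type*} [Monoid T]

theorem arcProd_zero (f : Fin n → T) (i : Fin n) : arcProd f i 0 = 1 := rfl

theorem arcProd_succ (f : Fin n → T) (i : Fin n) (m : ℕ) :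
    arcProd f i (m + 1) = f i * arcProd f (finRotate n i) m := by
  simp [arcProd, List.range_succ_eq_map, Function.comp_def, finRotate_pow_apply_succ]

theorem arcProd_succ' (f : Fin n → T) (i : Fin n) (m : ℕ) :
    arcProd f i (m + 1) = arcProd f i m * f ((finRotate n ^ m) i) := by
  simp [arcProd, List.range_succ]

theorem map_arcProd {T' : Type*} [Monoid T'] (g : T →* T') (f : Fin n → T) (i : Fin n) (m : ℕ) :
    g (arcProd f i m) = arcProd (fun j => g (f j)) i m := by
  simp [arcProd, map_list_prod, Function.comp_def]

theorem prod_map_finRange_finRotate_pow [NeZero n] (f : Fin n → T) (k : ℕ) :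
    ((List.finRange n).map fun t => f ((finRotate n ^ k) t)).prod =
      arcProd f ((finRotate n ^ k) 0) n := by
  have h : ∀ t : Fin n, (finRotate n ^ k) t = (finRotate n ^ (t : ℕ)) ((finRotate n ^ k) 0) := by
    intro t
    rw [← Equiv.Perm.mul_apply, ← pow_add, add_comm, pow_add, Equiv.Perm.mul_apply]
    congr 1
    ext
    simp [val_finRotate_pow, Nat.mod_eq_of_lt t.2]
  rw [show (fun t => f ((finRotate n ^ k) t)) = fun t : Fin n =>
    f ((finRotate n ^ (t : ℕ)) ((finRotate n ^ k) 0)) from funext fun t => congrArg f (h t)]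
  rw [arcProd, ← List.map_coe_finRange_eq_range, List.map_map]
  rfl

theorem lift_permWord [NeZero n] (f : Fin n → T) (k : ℕ) :
    FreeMonoid.lift f (permWord n (finRotate n ^ k)) = arcProd f ((finRotate n ^ k) 0) n := by
  rw [← prod_map_finRange_finRotate_pow, permWord, map_list_prod, List.map_map]
  simp [Function.comp_def]

theorem arcProd_inv_mul {G : Type*} [Group G] (c : Fin n → G) (i : Fin n) (m : ℕ) :
    arcProd (fun j => (c j)⁻¹ * c (finRotate n j)) i m = (c i)⁻¹ * c ((finRotate n ^ m) i) := by
  induction m generalizing i with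
  | zero => simp [arcProd_zero]
  | succ m ih => rw [arcProd_succ, ih, finRotate_pow_apply_succ, mul_assoc, mul_inv_cancel_left]

theorem arcProd_const (t : T) (i : Fin n) (m : ℕ) : arcProd (fun _ => t) i m = t ^ m := by
  simp [arcProd]

end ArcProd

namespace Scyc

variable {n : ℕ} [NeZero n]

/-- The universal property of `S_n`. -/
def lift {T : Type*} [Monoid T] (f : Fin n → T)
    (hf : ∀ i, arcProd f i n = arcProd f 0 n) : Scyc n →* T :=
  Con.lift _ (FreeMonoid.lift f) <| Con.conGen_le.2 <| by
    rintro _ _ ⟨rfl, k, rfl⟩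
    rw [Con.ker_rel, ← pow_zero (finRotate n), lift_permWord, lift_permWord, hf,
      hf ((finRotate n ^ k) 0)]

theorem lift_agen {T : Type*} [Monoid T] (f : Fin n → T)
    (hf : ∀ i, arcProd f i n = arcProd f 0 n) (i : Fin n) : lift f hf (agen i) = f i :=
  (Con.lift_mk' _ _).trans (FreeMonoid.lift_eval_of f i)

omit [NeZero n] in
theorem agen_induction {p : Scyc n → Prop} (one : p 1)
    (mul : ∀ i s, p s → p (agen i * s)) (s : Scyc n) : p s := by
  induction s using Con.induction_on with
  | H w =>
    induction w using FreeMonoid.inductionOn' with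
    | one => exact one
    | of_mul i w ih => exact mul i _ ih

theorem zc_eq : zc n = arcProd agen 0 n := by
  have := prod_map_finRange_finRotate_pow (agen (n := n)) 0
  simpa [zc] using this

theorem arcProd_agen (i : Fin n) : arcProd agen i n = zc n := by
  have h : ∀ k, (conGen (cycRel n)).mk' (permWord n (finRotate n ^ k)) =
      arcProd agen ((finRotate n ^ k) 0) n := fun k => by
    rw [← prod_map_finRange_finRotate_pow, permWord, map_list_prod, List.map_map]
    rfl
  have hi : (finRotate n ^ (i : ℕ)) 0 = i := by
    ext
    simp [val_finRotate_pow, Nat.mod_eq_of_lt i.2]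
  have h1 : (conGen (cycRel n)).mk' (permWord n (finRotate n ^ 0)) =
      (conGen (cycRel n)).mk' (permWord n (finRotate n ^ (i : ℕ))) :=
    (Con.eq _).2 (ConGen.Rel.of _ _ ⟨by rw [pow_zero], i, rfl⟩)
  rw [h, h, hi] at h1
  rw [zc_eq, ← h1, pow_zero, Equiv.Perm.one_apply]

theorem agen_mul_zc (i : Fin n) : agen i * zc n = zc n * agen i := by
  have h := arcProd_succ agen i n
  rwa [arcProd_succ', finRotate_pow_self, Equiv.Perm.one_apply, arcProd_agen, arcProd_agen,
    eq_comm] at h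

theorem commute_zc (s : Scyc n) : Commute (zc n) s := by
  induction s using agen_induction with
  | one => exact Commute.one_right _
  | mul i s ih => exact Commute.mul_right (agen_mul_zc i).symm ih

/-- The homomorphism to the free group on `c_i` that sends `a_i` to `c_i⁻¹ * c_{i+1}`. -/
def toFreeGroup : Scyc n →* FreeGroup (Fin n) :=
  lift (fun i => (FreeGroup.of i)⁻¹ * FreeGroup.of (finRotate n i)) fun i => by
    simp only [arcProd_inv_mul, finRotate_pow_self, Equiv.Perm.one_apply, inv_mul_cancel]

/-- The length homomorphism. -/
def length : Scyc n →* Multiplicative ℕ :=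
  lift (fun _ => Multiplicative.ofAdd 1) fun i => by rw [arcProd_const, arcProd_const]

theorem toFreeGroup_agen (i : Fin n) :
    toFreeGroup (agen i) = (FreeGroup.of i)⁻¹ * FreeGroup.of (finRotate n i) := lift_agen _ _ i

theorem length_agen (i : Fin n) : length (agen i) = Multiplicative.ofAdd 1 := lift_agen _ _ i

theorem toFreeGroup_arcProd (i : Fin n) (m : ℕ) : toFreeGroup (arcProd agen i m) =
    (FreeGroup.of i)⁻¹ * FreeGroup.of ((finRotate n ^ m) i) := by
  simp only [map_arcProd, toFreeGroup_agen, arcProd_inv_mul]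

theorem toFreeGroup_zc : toFreeGroup (zc n) = 1 := by
  rw [zc_eq, toFreeGroup_arcProd, finRotate_pow_self, Equiv.Perm.one_apply, inv_mul_cancel]

theorem length_zc : length (zc n) = Multiplicative.ofAdd n := by
  rw [zc_eq, map_arcProd]
  simp only [length_agen, arcProd_const, ← ofAdd_nsmul, smul_eq_mul, mul_one]

/-- The product of the arcs in a list of pairs (starting point, length). -/
def arcsProd (L : List (Fin n × ℕ)) : Scyc n := (L.map fun p => arcProd agen p.1 p.2).prod

/-- The word `c_{i₁}⁻¹ c_{j₁} c_{i₂}⁻¹ c_{j₂} ⋯` recording the end points of a list of arcs. -/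
def arcsWord (L : List (Fin n × ℕ)) : List (Fin n × Bool) :=
  L.flatMap fun p => [(p.1, false), ((finRotate n ^ p.2) p.1, true)]

omit [NeZero n] in
theorem arcsWord_cons (p : Fin n × ℕ) (L : List (Fin n × ℕ)) : arcsWord (p :: L) =
    (p.1, false) :: ((finRotate n ^ p.2) p.1, true) :: arcsWord L := rfl

/-- A list of arcs is reduced if no arc is trivial or a full turn, and no arc starts where the
previous one ends. -/
def ArcsReduced (L : List (Fin n × ℕ)) : Prop :=
  (∀ p ∈ L, 0 < p.2 ∧ p.2 < n) ∧ L.IsChain fun p q => (finRotate n ^ p.2) p.1 ≠ q.1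

theorem toFreeGroup_arcsProd (L : List (Fin n × ℕ)) :
    toFreeGroup (arcsProd L) = FreeGroup.mk (arcsWord L) := by
  induction L with
  | nil => simp [arcsProd, arcsWord, FreeGroup.one_eq_mk]
  | cons p L ih =>
    rw [arcsProd, List.map_cons, List.prod_cons, map_mul, toFreeGroup_arcProd]
    rw [arcsProd] at ih
    rw [ih, arcsWord_cons, FreeGroup.of, FreeGroup.of, FreeGroup.inv_mk, FreeGroup.mul_mk,
      FreeGroup.mul_mk]
    rfl

omit [NeZero n] in
theorem ArcsReduced.isReduced {L : List (Fin n × ℕ)} (hL : ArcsReduced L) :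
    FreeGroup.IsReduced (arcsWord L) := by
  obtain ⟨h1, h2⟩ := hL
  induction L with
  | nil => exact List.IsChain.nil
  | cons p L ih =>
    have hp := h1 p List.mem_cons_self
    have ih := ih (fun q hq => h1 q (List.mem_cons_of_mem _ hq)) h2.tail
    have h3 : (finRotate n ^ p.2) p.1 ≠ p.1 := fun h =>
      hp.1.ne' (eq_of_finRotate_pow_apply_eq hp.2 (hp.1.trans hp.2) (by simpa using h))
    rw [arcsWord_cons, FreeGroup.IsReduced, List.isChain_cons_cons]
    refine ⟨fun h => absurd h.symm h3, ?_⟩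
    cases L with
    | nil => exact List.isChain_singleton _
    | cons q L =>
      rw [arcsWord_cons] at ih ⊢
      rw [List.isChain_cons_cons]
      exact ⟨fun h => absurd h (List.isChain_cons_cons.1 h2).1, ih⟩

omit [NeZero n] in
theorem arcsWord_injOn {L L' : List (Fin n × ℕ)} (hL : ∀ p ∈ L, p.2 < n) (hL' : ∀ p ∈ L', p.2 < n)
    (h : arcsWord L = arcsWord L') : L = L' := by
  induction L generalizing L' with
  | nil => cases L' with
    | nil => rfl
    | cons q L' => simp [arcsWord] at h
  | cons p L ih => cases L' with
    | nil => simp [arcsWord] at h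
    | cons q L' =>
      obtain ⟨i, m⟩ := p
      obtain ⟨i', m'⟩ := q
      simp only [arcsWord_cons, List.cons.injEq, Prod.mk.injEq, and_true] at h
      obtain ⟨rfl, h1, h2⟩ := h
      have hm : m = m' :=
        eq_of_finRotate_pow_apply_eq (hL _ List.mem_cons_self) (hL' _ List.mem_cons_self) h1
      rw [hm, ih (fun q hq => hL q (List.mem_cons_of_mem _ hq))
          (fun q hq => hL' q (List.mem_cons_of_mem _ hq)) h2]

theorem exists_normal_form (hn : 2 ≤ n) (s : Scyc n) :
    ∃ (p : ℕ) (L : List (Fin n × ℕ)), ArcsReduced L ∧ s = zc n ^ p * arcsProd L := by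
  induction s using agen_induction with
  | one => exact ⟨0, [], ⟨by simp, List.IsChain.nil⟩, by simp [arcsProd]⟩
  | mul i s ih =>
    obtain ⟨p, L, ⟨h1, h2⟩, rfl⟩ := ih
    have hcomm : ∀ t, agen i * (zc n ^ p * t) = zc n ^ p * (agen i * t) := fun t => by
      rw [← mul_assoc, ← ((commute_zc (agen i)).pow_left p).eq, mul_assoc]
    by_cases hc : ∃ m L', L = (finRotate n i, m) :: L'
    · obtain ⟨m, L, rfl⟩ := hc
      have hm := h1 _ List.mem_cons_self
      have h1' := fun q hq => h1 q (List.mem_cons_of_mem _ hq)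
      have hmul : agen i * arcsProd ((finRotate n i, m) :: L) =
          arcProd agen i (m + 1) * arcsProd L := by
        rw [arcProd_succ, arcsProd, List.map_cons, List.prod_cons, mul_assoc]
        rfl
      rcases (show m + 1 = n ∨ m + 1 < n by have := hm.2; simp only at this; lia) with hmn | hmn
      · refine ⟨p + 1, L, ⟨h1', h2.tail⟩, ?_⟩
        rw [hcomm, hmul, hmn, arcProd_agen, pow_succ, mul_assoc]
      · refine ⟨p, (i, m + 1) :: L, ⟨?_, ?_⟩, ?_⟩
        · rintro q hq
          rcases List.mem_cons.1 hq with rfl | hq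
          · exact ⟨m.succ_pos, hmn⟩
          · exact h1' q hq
        · rw [List.isChain_cons] at h2 ⊢
          exact ⟨fun q hq => by rw [finRotate_pow_apply_succ]; exact h2.1 q hq, h2.2⟩
        · rw [hcomm, hmul]
          rfl
    · refine ⟨p, (i, 1) :: L, ⟨?_, ?_⟩, ?_⟩
      · rintro q hq
        rcases List.mem_cons.1 hq with rfl | hq
        · exact ⟨one_pos, hn⟩
        · exact h1 q hq
      · refine List.isChain_cons.2 ⟨fun q hq h => hc ?_, h2⟩
        cases L with
        | nil => simp at hq
        | cons q' L =>
          obtain rfl : q' = q := by simpa using hq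
          exact ⟨q'.2, L, by rw [show finRotate n i = q'.1 by simpa using h]⟩
      · rw [hcomm]
        rfl

/-- `S_n` embeds into the product of a free group and `ℕ`. -/
theorem ext_of_toFreeGroup_of_length (hn : 2 ≤ n) {s t : Scyc n}
    (h : toFreeGroup s = toFreeGroup t) (hl : length s = length t) : s = t := by
  obtain ⟨p, L, hL, rfl⟩ := exists_normal_form hn s
  obtain ⟨q, M, hM, rfl⟩ := exists_normal_form hn t
  simp only [map_mul, map_pow, toFreeGroup_zc, one_pow, one_mul, toFreeGroup_arcsProd] at h
  have h1 := congrArg FreeGroup.toWord h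
  rw [FreeGroup.toWord_mk, FreeGroup.toWord_mk, hL.isReduced.reduce_eq,
    hM.isReduced.reduce_eq] at h1
  obtain rfl := arcsWord_injOn (fun p hp => (hL.1 p hp).2) (fun p hp => (hM.1 p hp).2) h1
  rw [map_mul, map_mul, mul_left_inj, map_pow, map_pow, length_zc, ← ofAdd_nsmul, ← ofAdd_nsmul,
    EmbeddingLike.apply_eq_iff_eq, smul_eq_mul, smul_eq_mul] at hl
  rw [Nat.eq_of_mul_eq_mul_right (by lia) hl]

end Scyc

namespace FreeGroup

open MonoidAlgebra

variable (K : Type*) {ι : Type*} [Field K] [DecidableEq ι]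

/-- The matrix of a generator under the Fox representation with respect to the generator `p`. -/
noncomputable def foxUnit (p i : ι) :
    (Matrix (Fin 2) (Fin 2) (MonoidAlgebra K (FreeGroup ι)))ˣ where
  val := !![single (of i) 1, if i = p then 1 else 0; 0, 1]
  inv := !![single (of i)⁻¹ 1, if i = p then -single (of i)⁻¹ 1 else 0; 0, 1]
  val_inv := by
    split_ifs <;> simp [Matrix.one_fin_two, single_mul_single, one_def]
  inv_val := by
    split_ifs <;> simp [Matrix.one_fin_two, single_mul_single, one_def]

/-- The Fox representation of the free group with respect to the generator `p`. -/
noncomputable def foxMatrix (p : ι) :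
    FreeGroup ι →* Matrix (Fin 2) (Fin 2) (MonoidAlgebra K (FreeGroup ι)) :=
  (Units.coeHom _).comp (FreeGroup.lift (foxUnit K p))

theorem foxMatrix_of (p i : ι) : foxMatrix K p (of i) =
    !![single (of i) 1, if i = p then 1 else 0; 0, 1] := by
  simp [foxMatrix, foxUnit]

theorem foxMatrix_inv_of (p i : ι) : foxMatrix K p (of i)⁻¹ =
    !![single (of i)⁻¹ 1, if i = p then -single (of i)⁻¹ 1 else 0; 0, 1] := by
  rw [foxMatrix, MonoidHom.comp_apply, _root_.map_inv, lift_apply_of]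
  rfl

theorem foxMatrix_fst_col (p : ι) (g : FreeGroup ι) :
    foxMatrix K p g 0 0 = single g 1 ∧ foxMatrix K p g 1 0 = 0 := by
  induction g using FreeGroup.induction_on with
  | C1 => simp [one_def]
  | of i => simp [foxMatrix_of]
  | inv_of i => simp [foxMatrix_inv_of]
  | mul g h ihg ihh =>
    simp [Matrix.mul_apply, Fin.sum_univ_two, ihg, ihh, single_mul_single]

/-- The extension of the Fox representation to the group algebra. -/
noncomputable def foxHom (p : ι) : MonoidAlgebra K (FreeGroup ι) →ₐ[K]
    Matrix (Fin 2) (Fin 2) (MonoidAlgebra K (FreeGroup ι)) :=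
  MonoidAlgebra.lift K _ _ (foxMatrix K p)

theorem foxHom_single_one (p : ι) (g : FreeGroup ι) :
    foxHom K p (single g 1) = foxMatrix K p g := by
  rw [foxHom, MonoidAlgebra.lift_single, one_smul]

variable {K}

theorem foxHom_zero_zero (p : ι) (f : MonoidAlgebra K (FreeGroup ι)) : foxHom K p f 0 0 = f := by
  induction f using MonoidAlgebra.induction_linear with
  | zero => simp
  | add f g hf hg => rw [map_add, Matrix.add_apply, hf, hg]
  | single g c =>
    rw [foxHom, MonoidAlgebra.lift_single, Matrix.smul_apply, (foxMatrix_fst_col K p g).1,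
      smul_single, smul_eq_mul, mul_one]

/-- If `p`, `q`, `r` are distinct, then the left ideals generated by `c_p⁻¹ c_q - c_q⁻¹ c_r` and
`1 - (c_q⁻¹ c_r) ^ m` meet trivially. -/
theorem eq_zero_of_mul_sub_eq_mul_one_sub_pow {p q r : ι} (hpq : q ≠ p) (hpr : r ≠ p) (m : ℕ)
    {f g : MonoidAlgebra K (FreeGroup ι)}
    (h : f * (single ((of p)⁻¹ * of q) 1 - single ((of q)⁻¹ * of r) 1) =
      g * (1 - single (((of q)⁻¹ * of r) ^ m) 1)) : f = 0 := by
  have hv : foxMatrix K p ((of q)⁻¹ * of r) = !![single ((of q)⁻¹ * of r) 1, 0; 0, 1] := by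
    simp [foxMatrix_inv_of, foxMatrix_of, hpq, hpr, single_mul_single]
  have hvm : ∀ m, foxMatrix K p (((of q)⁻¹ * of r) ^ m) =
      !![single (((of q)⁻¹ * of r) ^ m) 1, 0; 0, 1] := fun m => by
    rw [map_pow, hv]
    induction m with
    | zero => simp [Matrix.one_fin_two, one_def]
    | succ m ih => rw [pow_succ, ih]; simp [single_mul_single, pow_succ]
  have hu : foxMatrix K p ((of p)⁻¹ * of q) =
      !![single ((of p)⁻¹ * of q) 1, -single (of p)⁻¹ 1; 0, 1] := by
    simp [foxMatrix_inv_of, foxMatrix_of, hpq, single_mul_single]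
  have h1 := congrFun (congrFun (congrArg (foxHom K p) h) 0) 1
  simp only [_root_.map_mul, map_sub, _root_.map_one, foxHom_single_one, hvm, hu, hv,
    Matrix.mul_apply, Fin.sum_univ_two, foxHom_zero_zero, Matrix.sub_apply] at h1
  simp only [Matrix.of_apply, Matrix.cons_val_zero, Matrix.cons_val_one, Matrix.cons_val',
    Matrix.cons_val_fin_one, Matrix.one_apply_eq, Matrix.one_apply_ne zero_ne_one, sub_self,
    sub_zero, mul_zero, add_zero, mul_neg, neg_eq_zero] at h1
  have h2 := congrArg (· * single (of p) 1) h1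
  simpa [mul_assoc, single_mul_single, ← one_def] using h2

theorem inv_of_mul_of_pow_ne_one {q r : ι} (hqr : r ≠ q) {m : ℕ} (hm : m ≠ 0) :
    ((of q)⁻¹ * of r) ^ m ≠ 1 := by
  intro h
  have := congrArg (FreeGroup.lift fun i => Multiplicative.ofAdd (if i = r then (1 : ℤ) else 0)) h
  rw [map_pow, _root_.map_mul, _root_.map_inv, lift_apply_of, lift_apply_of, _root_.map_one,
    if_pos rfl, if_neg hqr.symm, ofAdd_zero, inv_one, one_mul, ← ofAdd_nsmul, ofAdd_eq_one] at this
  simp [hm] at this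

end FreeGroup

namespace MonoidAlgebra

open Polynomial in
/-- The homomorphism `K[S] → K[G][X]` induced by a homomorphism to `G` and a grading of `S`. -/
noncomputable def toPolynomial (K : Type*) {S G : Type*} [Field K] [Monoid S] [Monoid G]
    (t : S →* G) (l : S →* Multiplicative ℕ) : MonoidAlgebra K S →ₐ[K] (MonoidAlgebra K G)[X] :=
  MonoidAlgebra.lift K _ _
    { toFun := fun s => monomial (l s).toAdd (single (t s) 1)
      map_one' := by simp [← one_def]
      map_mul' := fun s s' => by
        rw [monomial_mul_monomial, single_mul_single, map_mul t, map_mul l, toAdd_mul, mul_one] }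

section

variable {K S G : Type*} [Field K]

theorem rank_le_aleph0 [Countable S] : Module.rank K (MonoidAlgebra K S) ≤ Cardinal.aleph0 := by
  rw [← Cardinal.lift_le_aleph0, (coeffLinearEquiv K).lift_rank_eq, Cardinal.lift_le_aleph0,
    rank_finsupp_self, Cardinal.lift_le_aleph0, Cardinal.mk_le_aleph0_iff]
  infer_instance

instance [Countable K] [Countable S] : Countable (MonoidAlgebra K S) :=
  coeffEquiv.injective.countable

variable [Monoid S] [Monoid G]

theorem toPolynomial_single (t : S →* G) (l : S →* Multiplicative ℕ) (s : S) (c : K) :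
    toPolynomial K t l (single s c) = Polynomial.monomial (l s).toAdd (single (t s) c) := by
  rw [toPolynomial, MonoidAlgebra.lift_single]
  exact (Polynomial.smul_monomial _ _ _).trans (by rw [smul_single, smul_eq_mul, mul_one])

theorem coeff_coeff_toPolynomial {t : S →* G} {l : S →* Multiplicative ℕ}
    (htl : ∀ s s', t s = t s' → l s = l s' → s = s') (f : MonoidAlgebra K S) (s : S) :
    ((toPolynomial K t l f).coeff (l s).toAdd).coeff (t s) = f.coeff s := by
  classical
  induction f using MonoidAlgebra.induction_linear with
  | zero => simp
  | add f g hf hg => simp [hf, hg]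
  | single s' c =>
    rw [toPolynomial_single, Polynomial.coeff_monomial]
    by_cases h : s' = s
    · simp [h]
    · split_ifs with hl
      · have ht : t s' ≠ t s := fun ht => h (htl _ _ ht (Multiplicative.toAdd.injective hl))
        simp [h, ht]
      · simp [h]

theorem toPolynomial_injective {t : S →* G} {l : S →* Multiplicative ℕ}
    (htl : ∀ s s', t s = t s' → l s = l s' → s = s') :
    Function.Injective (toPolynomial K t l) := fun f g h => by
  ext s
  rw [← coeff_coeff_toPolynomial htl, h, coeff_coeff_toPolynomial htl]

/-- An element of positive degree is transcendental. -/
theorem transcendental_single {l : S →* Multiplicative ℕ} {z : S} (hz : l z ≠ 1) :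
    Transcendental K (single z (1 : K)) := by
  intro h
  have h1 := h.algHom (MonoidAlgebra.lift K (Polynomial K) S
    { toFun := fun s => Polynomial.X ^ (l s).toAdd
      map_one' := by simp
      map_mul' := fun s s' => by rw [map_mul, toAdd_mul, pow_add] })
  rw [MonoidAlgebra.lift_single, one_smul] at h1
  exact (Polynomial.transcendental_X K).pow (Nat.pos_of_ne_zero fun h0 => hz h0) h1

theorem single_mem_center {z : S} (hz : ∀ s, Commute z s) :
    single z (1 : K) ∈ Subalgebra.center K (MonoidAlgebra K S) := by
  rw [Subalgebra.mem_center_iff]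
  intro f
  induction f using MonoidAlgebra.induction_linear with
  | zero => simp
  | add f g hf hg => rw [add_mul, mul_add, hf, hg]
  | single s c => rw [single_mul_single, single_mul_single, (hz s).eq, mul_one, one_mul]

end

/-- Let `S` be a countable submonoid of the product of a free group and `ℕ` which contains a central
element `z = (1, m)` of positive degree, as well as `a = (c_p⁻¹ c_q, 1)` and `b = (c_q⁻¹ c_r, 1)`.
Then an algebra isomorphic to `K[S]` has a faithful simple module iff `K` is countable. -/
theorem exists_faithful_simple_module_iff_countable.{u} {K A : Type u} {S ι : Type*} [Field K]
    [Ring A] [Algebra K A] [Monoid S] [Countable S] (e : A ≃ₐ[K] MonoidAlgebra K S)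
    {t : S →* FreeGroup ι} {l : S →* Multiplicative ℕ}
    (htl : ∀ s s', t s = t s' → l s = l s' → s = s') {p q r : ι} (hpq : q ≠ p) (hpr : r ≠ p)
    (hqr : r ≠ q) {a b z : S} (hta : t a = (FreeGroup.of p)⁻¹ * FreeGroup.of q)
    (htb : t b = (FreeGroup.of q)⁻¹ * FreeGroup.of r) (htz : t z = 1)
    (hla : l a = Multiplicative.ofAdd 1) (hlb : l b = Multiplicative.ofAdd 1) {m : ℕ} (hm : m ≠ 0)
    (hlz : l z = Multiplicative.ofAdd m) (hz : ∀ s, Commute z s) :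
    (∃ (V : Type u) (_ : AddCommGroup V) (_ : Module A V), IsSimpleModule A V ∧ FaithfulSMul A V) ↔
      Countable K := by
  classical
  constructor
  · rintro ⟨V, _, _, _, _⟩
    have hA : Module.rank K A ≤ Cardinal.aleph0 := by
      rw [← Cardinal.lift_le_aleph0, e.toLinearEquiv.lift_rank_eq, Cardinal.lift_le_aleph0]
      exact rank_le_aleph0
    refine countable_of_faithful_simple_module (V := V) hA (z := e.symm (single z 1)) ?_ ?_
    · rw [Subalgebra.mem_center_iff]
      intro x
      apply e.injective
      rw [map_mul, map_mul, e.apply_symm_apply]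
      exact Subalgebra.mem_center_iff.1 (single_mem_center hz) (e x)
    · intro h
      refine transcendental_single (K := K) (l := l) (z := z) ?_ ?_
      · rw [hlz]
        exact fun h0 => hm h0
      · simpa using h.algHom (e : A →ₐ[K] MonoidAlgebra K S)
  · intro hK
    have : Countable A := e.injective.countable
    obtain ⟨M, hM⟩ := exists_faithful_simple_module_of_countable
      (φ := ((toPolynomial K t l).comp (e : A →ₐ[K] MonoidAlgebra K S)).toRingHom)
      ((toPolynomial_injective htl).comp e.injective)
      (x := e.symm (single a 1 - single b 1)) (y := e.symm (single z 1 - single (b ^ m) 1))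
      (i := 0) (j := m) (α := single (t a) 1 - single (t b) 1) (β := 1 - single (t b ^ m) 1)
      (by simp [toPolynomial_single, hla, hlb])
      (by simp [toPolynomial_single, hlz, hlb, htz, one_def])
      (by
        rw [htb, sub_ne_zero, one_def]
        intro h
        exact FreeGroup.inv_of_mul_of_pow_ne_one hqr hm (single_left_injective one_ne_zero h).symm)
      (fun f g h => by
        rw [hta, htb] at h
        exact FreeGroup.eq_zero_of_mul_sub_eq_mul_one_sub_pow hpq hpr m h)
    exact ⟨A ⧸ M, inferInstance, inferInstance, hM⟩

/-- The opposite of a monoid algebra is the algebra of the opposite monoid. -/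
noncomputable def opAlgEquiv (K S : Type*) [Field K] [Monoid S] :
    (MonoidAlgebra K S)ᵐᵒᵖ ≃ₐ[K] MonoidAlgebra K Sᵐᵒᵖ :=
  AlgEquiv.ofRingEquiv
    (f := MonoidAlgebra.opRingEquiv.trans (mapRingEquiv _ (RingEquiv.toOpposite K).symm))
    fun c => by
      rw [MulOpposite.algebraMap_apply]
      simp

end MonoidAlgebra

namespace Scyc

instance (n : ℕ) : Countable (Scyc n) :=
  Function.Surjective.countable (f := (conGen (cycRel n)).mk') Con.mk'_surjective

end Scyc

/-- `K[S_n]` is right primitive (has a faithful simple right module, i.e. a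
faithful simple module over the opposite ring) iff `K` is countable, and likewise
`K[S_n]` is left primitive iff `K` is countable. -/
theorem primitive_iff_countable.{u} (K : Type u) [Field K] (n : ℕ) (hn : 3 ≤ n) :
    ((∃ (V : Type u) (_ : AddCommGroup V) (_ : Module (MonoidAlgebra K (Scyc n))ᵐᵒᵖ V),
        IsSimpleModule (MonoidAlgebra K (Scyc n))ᵐᵒᵖ V ∧
          FaithfulSMul (MonoidAlgebra K (Scyc n))ᵐᵒᵖ V) ↔ Countable K) ∧
    ((∃ (V : Type u) (_ : AddCommGroup V) (_ : Module (MonoidAlgebra K (Scyc n)) V),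
        IsSimpleModule (MonoidAlgebra K (Scyc n)) V ∧
          FaithfulSMul (MonoidAlgebra K (Scyc n)) V) ↔ Countable K) := by
  have : NeZero n := ⟨by lia⟩
  have hext := @Scyc.ext_of_toFreeGroup_of_length n _ (by lia)
  let p : Fin n := ⟨0, by lia⟩
  let q : Fin n := ⟨1, by lia⟩
  let r : Fin n := ⟨2, by lia⟩
  have hpq : q ≠ p := by simp [p, q]
  have hpr : r ≠ p := by simp [p, r]
  have hqr : r ≠ q := by simp [q, r]
  have hp : finRotate n p = q := by
    ext
    simp [p, q, Nat.mod_eq_of_lt (show 1 < n by lia)]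
  have hq : finRotate n q = r := by
    ext
    simpa [q, r, Nat.mod_eq_of_lt (show 2 < n by lia)] using val_finRotate_pow 1 q
  have ha : Scyc.toFreeGroup (agen p) = (FreeGroup.of p)⁻¹ * FreeGroup.of q := by
    rw [Scyc.toFreeGroup_agen, hp]
  have hb : Scyc.toFreeGroup (agen q) = (FreeGroup.of q)⁻¹ * FreeGroup.of r := by
    rw [Scyc.toFreeGroup_agen, hq]
  constructor
  · have : Countable (Scyc n)ᵐᵒᵖ := MulOpposite.unop_injective.countable
    refine MonoidAlgebra.exists_faithful_simple_module_iff_countable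
      (MonoidAlgebra.opAlgEquiv K (Scyc n))
      (t := (MulEquiv.inv' _).symm.toMonoidHom.comp (MonoidHom.op Scyc.toFreeGroup))
      (l := MonoidHom.fromOpposite Scyc.length fun _ _ => Commute.all _ _)
      (fun s s' h h' => MulOpposite.unop_injective
        (hext ((MulEquiv.inv' _).symm.injective.comp MulOpposite.op_injective h) h'))
      hqr.symm hpr.symm hpq.symm (a := MulOpposite.op (agen q)) (b := MulOpposite.op (agen p))
      (z := MulOpposite.op (zc n)) ?_ ?_ ?_ (Scyc.length_agen q) (Scyc.length_agen p)
      (NeZero.ne n) Scyc.length_zc fun s => (Scyc.commute_zc s.unop).op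
    · simp [hb]
    · simp [ha]
    · simp [Scyc.toFreeGroup_zc]
  · exact MonoidAlgebra.exists_faithful_simple_module_iff_countable AlgEquiv.refl
      (fun _ _ h h' => hext h h') hpq hpr hqr ha hb Scyc.toFreeGroup_zc (Scyc.length_agen p)
      (Scyc.length_agen q) (NeZero.ne n) Scyc.length_zc Scyc.commute_zc
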